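/- Any proper non-abelian quotient of a finite dihedral, semi-dihedral, or generalized quaternion 2-group is dihedral; consequently, the only infinite inverse limit of a surjective inverse system of finite dihedral, semi-dihedral or generalized quaternion 2-groups is the infinite pro-2 dihedral group D_{2^∞}. -/

import Mathlib

/-- The canonical projection between dihedral groups `DihedralGroup m → DihedralGroup n`
when `n ∣ m`. -/
def dihedralProj (m n : ℕ) (h : n ∣ m) : DihedralGroup m →* DihedralGroup n where
  toFun x := match x with
    | .r i => .r (ZMod.castHom h (ZMod n) i)
    | .sr i => .sr (ZMod.castHom h (ZMod n) i)
  map_one' := by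
    show DihedralGroup.r ((ZMod.castHom h (ZMod n)) 0) = 1
    rw [map_zero, DihedralGroup.one_def]
  map_mul' := by
    rintro (i | i) (j | j) <;>
      simp [DihedralGroup.r_mul_r, DihedralGroup.r_mul_sr, DihedralGroup.sr_mul_r,
        DihedralGroup.sr_mul_sr, map_add, map_sub]

/-- The semidihedral group of order `2^n` (`n ≥ 4`), presented as
`⟨a, b | a^{2^{n-1}}, b², b a b a^{-2^{n-2}+1}⟩`. -/
abbrev SemidihedralGroup (n : ℕ) : Type :=
  PresentedGroup ({FreeGroup.of (0 : Fin 2) ^ (2 ^ (n - 1)),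
    FreeGroup.of (1 : Fin 2) ^ 2,
    FreeGroup.of (1 : Fin 2) * FreeGroup.of (0 : Fin 2) * FreeGroup.of (1 : Fin 2) *
      FreeGroup.of (0 : Fin 2) ^ (-(2 ^ (n - 2) : ℤ) + 1)} : Set (FreeGroup (Fin 2)))

/-- `G` is a finite dihedral, semidihedral, or generalized quaternion `2`-group
(of order `2^m`). -/
def IsDSQ2Group (G : Type) [Group G] : Prop :=
  (∃ m, 3 ≤ m ∧ Nonempty (G ≃* DihedralGroup (2 ^ (m - 1)))) ∨
  (∃ m, 4 ≤ m ∧ Nonempty (G ≃* SemidihedralGroup m)) ∨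
  (∃ m, 3 ≤ m ∧ Nonempty (G ≃* QuaternionGroup (2 ^ (m - 2))))

/-- The infinite pro-`2` dihedral group `D_{2^∞}`, as the inverse limit of the natural
surjective system of finite dihedral `2`-groups. -/
def D2inf : Subgroup (∀ n : ℕ, DihedralGroup (2 ^ n)) where
  carrier := {x | ∀ n, dihedralProj (2 ^ (n + 1)) (2 ^ n)
    (pow_dvd_pow 2 (Nat.le_succ n)) (x (n + 1)) = x n}
  one_mem' := fun n => by simp
  mul_mem' := by
    intro a b ha hb n
    simp only [Pi.mul_apply, map_mul, ha n, hb n]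
  inv_mem' := by
    intro a ha n
    simp only [Pi.inv_apply, map_inv, ha n]

/-- Generators `a`, `b` of a group in which `b` is an involution inverting `a`. -/
structure IsDihedralPair {G : Type*} [Group G] (a b : G) : Prop where
  mul_self : b * b = 1
  conj : b * a * b⁻¹ = a⁻¹
  closure_eq : Subgroup.closure {a, b} = ⊤

/-- Generators `a`, `b` of a group satisfying the relations common to the dihedral, semidihedral
and generalized quaternion `2`-groups: up to the factor `a ^ 2 ^ k`, which squares to `1`,
the element `b` is an involution inverting `a`. -/
structure IsDSQPair {G : Type*} [Group G] (k : ℕ) (a b : G) : Prop where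
  pow_eq_one : a ^ 2 ^ (k + 1) = 1
  mul_self : b * b = 1 ∨ b * b = a ^ 2 ^ k
  conj : b * a * b⁻¹ = a⁻¹ ∨ b * a * b⁻¹ = a⁻¹ * a ^ 2 ^ k
  closure_eq : Subgroup.closure {a, b} = ⊤

theorem Subgroup.closure_pair_map_eq_top {G H : Type*} [Group G] [Group H] {a b : G}
    (h : Subgroup.closure {a, b} = ⊤) {φ : G →* H} (hφ : Function.Surjective φ) :
    Subgroup.closure {φ a, φ b} = ⊤ := by
  rw [← Set.image_pair, ← MonoidHom.map_closure, h, Subgroup.map_top_of_surjective φ hφ]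

theorem IsDihedralPair.map {G H : Type*} [Group G] [Group H] {a b : G}
    (h : IsDihedralPair a b) {φ : G →* H} (hφ : Function.Surjective φ) :
    IsDihedralPair (φ a) (φ b) where
  mul_self := by rw [← map_mul, h.mul_self, map_one]
  conj := by simpa using congrArg φ h.conj
  closure_eq := Subgroup.closure_pair_map_eq_top h.closure_eq hφ

theorem IsDSQPair.map {G H : Type*} [Group G] [Group H] {k : ℕ} {a b : G}
    (h : IsDSQPair k a b) {φ : G →* H} (hφ : Function.Surjective φ) :
    IsDSQPair k (φ a) (φ b) where
  pow_eq_one := by rw [← map_pow, h.pow_eq_one, map_one]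
  mul_self := h.mul_self.imp (fun h => by simpa using congrArg φ h)
    (fun h => by simpa using congrArg φ h)
  conj := h.conj.imp (fun h => by simpa using congrArg φ h)
    (fun h => by simpa using congrArg φ h)
  closure_eq := Subgroup.closure_pair_map_eq_top h.closure_eq hφ

theorem eq_zpow_or_eq_zpow_mul {G : Type*} [Group G] {a b : G} {s t : ℤ}
    (hb : b * b = a ^ s) (hab : b * a * b⁻¹ = a ^ t)
    (hgen : Subgroup.closure {a, b} = ⊤) (g : G) :
    ∃ i : ℤ, g = a ^ i ∨ g = a ^ i * b := by
  have hcomm (j : ℤ) : b * a ^ j = a ^ (t * j) * b := by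
    have : SemiconjBy b a (a ^ t) := by
      rw [SemiconjBy, ← hab]; group
    rw [zpow_mul]
    exact this.zpow_right j
  have hg : g ∈ Subgroup.closure {a, b} := hgen ▸ Subgroup.mem_top g
  induction hg using Subgroup.closure_induction with
  | mem x hx =>
    rcases hx with rfl | rfl
    · exact ⟨1, Or.inl (by simp)⟩
    · exact ⟨0, Or.inr (by simp)⟩
  | one => exact ⟨0, Or.inl (by simp)⟩
  | mul x y _ _ hx hy =>
    obtain ⟨i, rfl | rfl⟩ := hx <;> obtain ⟨j, rfl | rfl⟩ := hy
    · exact ⟨i + j, Or.inl (zpow_add a i j).symm⟩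
    · exact ⟨i + j, Or.inr (by rw [zpow_add, mul_assoc])⟩
    · exact ⟨i + t * j, Or.inr (by rw [mul_assoc, hcomm, zpow_add, mul_assoc])⟩
    · refine ⟨i + t * j + s, Or.inl ?_⟩
      rw [mul_assoc, ← mul_assoc b, hcomm, mul_assoc (a ^ (t * j)), hb, zpow_add, zpow_add,
        mul_assoc]
  | inv x _ hx =>
    obtain ⟨i, rfl | rfl⟩ := hx
    · exact ⟨-i, Or.inl (zpow_neg a i).symm⟩
    · refine ⟨t * (-s - i), Or.inr ?_⟩
      rw [← hcomm, inv_eq_iff_mul_eq_one, mul_assoc, ← mul_assoc b, hb, ← zpow_add, ← zpow_add,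
        show i + (s + (-s - i)) = 0 by ring, zpow_zero]

theorem IsDihedralPair.eq_zpow_or_eq_mul_zpow {G : Type*} [Group G] {a b : G}
    (h : IsDihedralPair a b) (g : G) : ∃ i : ℤ, g = a ^ i ∨ g = b * a ^ i := by
  obtain ⟨i, hi | hi⟩ := eq_zpow_or_eq_zpow_mul (s := 0) (t := -1)
    (by simpa using h.mul_self) (by simpa using h.conj) h.closure_eq g⁻¹
  · exact ⟨-i, Or.inl (by rw [zpow_neg, ← hi, inv_inv])⟩
  · refine ⟨-i, Or.inr ?_⟩
    rw [← inv_inv g, hi, mul_inv_rev, zpow_neg, inv_eq_of_mul_eq_one_left h.mul_self]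

theorem Subgroup.notMem_zpowers_of_closure_pair_eq_top {G : Type*} [Group G] {a b : G}
    (h : Subgroup.closure {a, b} = ⊤) (hG : ∃ x y : G, x * y ≠ y * x) :
    b ∉ Subgroup.zpowers a := by
  intro hb
  have htop : Subgroup.zpowers a = ⊤ := by
    rw [eq_top_iff, ← h, Subgroup.closure_le]
    rintro x (rfl | rfl)
    exacts [Subgroup.mem_zpowers x, hb]
  obtain ⟨x, y, hxy⟩ := hG
  obtain ⟨i, rfl⟩ : x ∈ Subgroup.zpowers a := htop ▸ Subgroup.mem_top x
  obtain ⟨j, rfl⟩ : y ∈ Subgroup.zpowers a := htop ▸ Subgroup.mem_top y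
  exact hxy ((Commute.refl a).zpow_zpow i j)

/-- A nonabelian group generated by a dihedral pair `a`, `b` is dihedral. -/
theorem IsDihedralPair.exists_mulEquiv {G : Type*} [Group G] {a b : G}
    (h : IsDihedralPair a b) (hG : ∃ x y : G, x * y ≠ y * x) {N : ℕ} (hN : orderOf a = N) :
    ∃ e : DihedralGroup N ≃* G,
      ∀ i : ℤ, e (.r i) = a ^ i ∧ e (.sr i) = b * a ^ i := by
  have hcomm (j : ℤ) : a ^ j * b = b * a ^ (-j) := by
    have : SemiconjBy b (a⁻¹) a := by
      have := h.conj
      rw [SemiconjBy, ← this, ← mul_assoc, ← mul_assoc, h.mul_self, one_mul,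
        inv_eq_of_mul_eq_one_left h.mul_self]
    simpa using (this.zpow_right j).symm
  have hbmem := Subgroup.notMem_zpowers_of_closure_pair_eq_top h.closure_eq hG
  have hcast {i j : ℤ} : a ^ i = a ^ j ↔ (i : ZMod N) = j := by
    rw [zpow_eq_zpow_iff_modEq, hN, ZMod.intCast_eq_intCast_iff]
  let ψ : DihedralGroup N → G := fun x => match x with
    | .r i => a ^ (i.cast : ℤ)
    | .sr i => b * a ^ (i.cast : ℤ)
  have hψr (i : ℤ) : ψ (.r i) = a ^ i := hcast.2 (by simp)
  have hψs (i : ℤ) : ψ (.sr i) = b * a ^ i := congrArg (b * ·) (hψr i)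
  have hmul (x y : DihedralGroup N) : ψ (x * y) = ψ x * ψ y := by
    rcases x with i | i <;> rcases y with j | j <;>
      obtain ⟨i, rfl⟩ := ZMod.intCast_surjective i <;>
      obtain ⟨j, rfl⟩ := ZMod.intCast_surjective j
    · rw [DihedralGroup.r_mul_r, ← Int.cast_add, hψr, hψr, hψr, zpow_add]
    · rw [DihedralGroup.r_mul_sr, ← Int.cast_sub, hψr, hψs, hψs, ← mul_assoc, hcomm, mul_assoc,
        ← zpow_add, neg_add_eq_sub]
    · rw [DihedralGroup.sr_mul_r, ← Int.cast_add, hψr, hψs, hψs, zpow_add, mul_assoc]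
    · rw [DihedralGroup.sr_mul_sr, ← Int.cast_sub, hψr, hψs, hψs, mul_assoc, ← mul_assoc (a ^ i),
        hcomm, mul_assoc, ← mul_assoc, h.mul_self, one_mul, ← zpow_add, neg_add_eq_sub]
  let Ψ : DihedralGroup N →* G := MonoidHom.mk' ψ hmul
  have hinj : Function.Injective Ψ := by
    rw [injective_iff_map_eq_one]
    rintro (i | i) hi <;> obtain ⟨i, rfl⟩ := ZMod.intCast_surjective i
    · have hi : a ^ i = a ^ (0 : ℤ) := by rw [← hψr, zpow_zero]; exact hi
      rw [hcast.1 hi, Int.cast_zero, DihedralGroup.one_def]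
    · have hi : b * a ^ i = 1 := by rw [← hψs]; exact hi
      exact absurd ⟨-i, by simp [eq_inv_of_mul_eq_one_left hi]⟩ hbmem
  have hsurj : Function.Surjective Ψ := by
    intro g
    obtain ⟨i, rfl | rfl⟩ := h.eq_zpow_or_eq_mul_zpow g
    · exact ⟨.r i, hψr i⟩
    · exact ⟨.sr i, hψs i⟩
  exact ⟨MulEquiv.ofBijective Ψ ⟨hinj, hsurj⟩, fun i => ⟨hψr i, hψs i⟩⟩

theorem DihedralGroup.isDihedralPair (n : ℕ) :
    IsDihedralPair (.r 1 : DihedralGroup n) (.sr 0) where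
  mul_self := DihedralGroup.sr_mul_self 0
  conj := by simp
  closure_eq := by
    rw [eq_top_iff]
    have hr (i : ℤ) : (.r i : DihedralGroup n) ∈
        Subgroup.closure ({.r 1, .sr 0} : Set (DihedralGroup n)) := by
      rw [← DihedralGroup.r_one_zpow]
      exact Subgroup.zpow_mem _ (Subgroup.subset_closure (by simp)) i
    rintro (i | i) - <;> obtain ⟨i, rfl⟩ := ZMod.intCast_surjective i
    · exact hr i
    · have : (.sr i : DihedralGroup n) = .sr 0 * .r i := by simp
      rw [this]
      exact Subgroup.mul_mem _ (Subgroup.subset_closure (by simp)) (hr i)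

theorem DihedralGroup.isDSQPair (k : ℕ) :
    IsDSQPair k (.r 1 : DihedralGroup (2 ^ (k + 1))) (.sr 0) where
  pow_eq_one := DihedralGroup.r_one_pow_n
  mul_self := Or.inl (DihedralGroup.isDihedralPair _).mul_self
  conj := Or.inl (DihedralGroup.isDihedralPair _).conj
  closure_eq := (DihedralGroup.isDihedralPair _).closure_eq

theorem QuaternionGroup.isDSQPair (k : ℕ) :
    IsDSQPair k (.a 1 : QuaternionGroup (2 ^ k)) (.xa 0) where
  pow_eq_one := by rw [pow_succ']; exact QuaternionGroup.a_one_pow_n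
  mul_self := Or.inr (by simp)
  conj := Or.inl (by rw [mul_inv_eq_iff_eq_mul, eq_inv_mul_iff_mul_eq]; simp)
  closure_eq := by
    rw [eq_top_iff]
    have hr (i : ℕ) : (.a i : QuaternionGroup (2 ^ k)) ∈
        Subgroup.closure ({.a 1, .xa 0} : Set (QuaternionGroup (2 ^ k))) := by
      rw [← QuaternionGroup.a_one_pow]
      exact Subgroup.pow_mem _ (Subgroup.subset_closure (by simp)) i
    rintro (i | i) - <;> obtain ⟨i, rfl⟩ := ZMod.natCast_zmod_surjective i
    · exact hr i
    · have : (.xa i : QuaternionGroup (2 ^ k)) = .xa 0 * .a i := by simp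
      rw [this]
      exact Subgroup.mul_mem _ (Subgroup.subset_closure (by simp)) (hr i)

theorem mul_mul_inv_eq_of_mul_zpow_eq_one {G : Type*} [Group G] {a b : G} {n : ℕ}
    (hb : b * b = 1) (h : b * a * b * a ^ (-(n : ℤ) + 1) = 1) : b * a * b⁻¹ = a⁻¹ * a ^ n := by
  rw [inv_eq_of_mul_eq_one_left hb, eq_inv_of_mul_eq_one_left h]
  group

theorem SemidihedralGroup.isDSQPair (k : ℕ) :
    IsDSQPair k (PresentedGroup.of 0 : SemidihedralGroup (k + 2)) (PresentedGroup.of 1) := by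
  have h2 : (PresentedGroup.of 1 : SemidihedralGroup (k + 2)) * PresentedGroup.of 1 = 1 := by
    rw [← sq]
    exact PresentedGroup.one_of_mem (by simp)
  refine ⟨PresentedGroup.one_of_mem (by simp), Or.inl h2, Or.inr ?_, ?_⟩
  · exact mul_mul_inv_eq_of_mul_zpow_eq_one h2 (PresentedGroup.one_of_mem (by simp))
  · rw [eq_top_iff, ← PresentedGroup.closure_range_of, Subgroup.closure_le]
    rintro _ ⟨i, rfl⟩
    apply Subgroup.subset_closure
    fin_cases i <;> simp

theorem IsDSQ2Group.exists_isDSQPair {G : Type} [Group G] (h : IsDSQ2Group G) :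
    ∃ (k : ℕ) (a b : G), IsDSQPair k a b := by
  rcases h with ⟨m, hm, ⟨e⟩⟩ | ⟨m, hm, ⟨e⟩⟩ | ⟨m, hm, ⟨e⟩⟩ <;>
    obtain ⟨k, rfl⟩ := Nat.exists_eq_add_of_le' (show 2 ≤ m by omega)
  · exact ⟨k, _, _, (DihedralGroup.isDSQPair k).map (φ := e.symm.toMonoidHom) e.symm.surjective⟩
  · exact ⟨k, _, _, (SemidihedralGroup.isDSQPair k).map (φ := e.symm.toMonoidHom)
      e.symm.surjective⟩
  · exact ⟨k, _, _, (QuaternionGroup.isDSQPair k).map (φ := e.symm.toMonoidHom) e.symm.surjective⟩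

theorem DihedralGroup.not_commute {n : ℕ} (hn : 2 < n) :
    (.r 1 * .sr 0 : DihedralGroup n) ≠ .sr 0 * .r 1 := by
  have : Fact (2 < n) := ⟨hn⟩
  simpa using ZMod.neg_one_ne_one (n := n)

theorem SemidihedralGroup.not_commute {m : ℕ} (hm : 4 ≤ m) :
    (PresentedGroup.of 0 * PresentedGroup.of 1 : SemidihedralGroup m) ≠
      PresentedGroup.of 1 * PresentedGroup.of 0 := by
  obtain ⟨k, rfl⟩ := Nat.exists_eq_add_of_le' (show 2 ≤ m by omega)
  have h4 : 2 < 2 ^ k :=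
    calc 2 < 2 ^ 2 := by norm_num
      _ ≤ 2 ^ k := Nat.pow_le_pow_right (by norm_num) (by omega)
  let v : Fin 2 → DihedralGroup (2 ^ k) := ![.r 1, .sr 0]
  have hv : ∀ w ∈ ({FreeGroup.of (0 : Fin 2) ^ (2 ^ (k + 2 - 1)),
      FreeGroup.of (1 : Fin 2) ^ 2,
      FreeGroup.of (1 : Fin 2) * FreeGroup.of (0 : Fin 2) * FreeGroup.of (1 : Fin 2) *
        FreeGroup.of (0 : Fin 2) ^ (-(2 ^ (k + 2 - 2) : ℤ) + 1)} : Set (FreeGroup (Fin 2))),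
      FreeGroup.lift v w = 1 := by
    have hz : ((2 : ZMod (2 ^ k)) ^ k) = 0 := by
      exact_mod_cast ZMod.natCast_self (2 ^ k)
    rintro w (rfl | rfl | rfl)
    · simp [v, pow_succ]
    · simp [v, sq]
    · simp [v, hz]
  intro h
  have := congrArg (PresentedGroup.toGroup hv) h
  rw [map_mul, map_mul, PresentedGroup.toGroup.of, PresentedGroup.toGroup.of] at this
  exact DihedralGroup.not_commute h4 this

theorem QuaternionGroup.not_commute {n : ℕ} (hn : 2 ≤ n) :
    (.a 1 * .xa 0 : QuaternionGroup n) ≠ .xa 0 * .a 1 := by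
  have : Fact (2 < 2 * n) := ⟨by omega⟩
  simpa using ZMod.neg_one_ne_one (n := 2 * n)

theorem IsDSQ2Group.exists_mul_ne_mul {G : Type} [Group G] (h : IsDSQ2Group G) :
    ∃ x y : G, x * y ≠ y * x := by
  have key {K : Type} [Group K] (e : G ≃* K) {x y : K} (hxy : x * y ≠ y * x) :
      ∃ x y : G, x * y ≠ y * x :=
    ⟨e.symm x, e.symm y, by simpa only [← map_mul] using e.symm.injective.ne hxy⟩
  rcases h with ⟨m, hm, ⟨e⟩⟩ | ⟨m, hm, ⟨e⟩⟩ | ⟨m, hm, ⟨e⟩⟩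
  · refine key e (DihedralGroup.not_commute ?_)
    calc 2 < 2 ^ 2 := by norm_num
      _ ≤ 2 ^ (m - 1) := Nat.pow_le_pow_right (by norm_num) (by omega)
  · exact key e (SemidihedralGroup.not_commute hm)
  · refine key e (QuaternionGroup.not_commute ?_)
    calc 2 = 2 ^ 1 := by norm_num
      _ ≤ 2 ^ (m - 2) := Nat.pow_le_pow_right (by norm_num) (by omega)

/-- The images of the generators of a dihedral, semidihedral or generalized quaternion `2`-group
in a proper nonabelian quotient form a dihedral pair. -/
theorem IsDSQPair.isDihedralPair_map {G H : Type*} [Group G] [Group H] {k : ℕ} {a b : G}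
    (h : IsDSQPair k a b) {φ : G →* H} (hφ : Function.Surjective φ) (hker : φ.ker ≠ ⊥)
    (hH : ∃ x y : H, x * y ≠ y * x) :
    IsDihedralPair (φ a) (φ b) ∧ φ a ^ 2 ^ k = 1 := by
  obtain ⟨s, hs⟩ : ∃ s : ℤ, b * b = a ^ s :=
    h.mul_self.elim (fun h => ⟨0, by simpa using h⟩) (fun h => ⟨2 ^ k, by rw [h]; norm_cast⟩)
  obtain ⟨t, ht⟩ : ∃ t : ℤ, b * a * b⁻¹ = a ^ t :=
    h.conj.elim (fun h => ⟨-1, by simpa using h⟩)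
      (fun h => ⟨-1 + (2 ^ k : ℕ), by rw [h, zpow_add, zpow_natCast, zpow_neg_one]⟩)
  have hpow : φ a ^ 2 ^ k = 1 := by
    obtain ⟨g, hg, hg1⟩ := φ.ker.bot_or_exists_ne_one.resolve_left hker
    rw [MonoidHom.mem_ker] at hg
    obtain ⟨i, rfl | rfl⟩ := eq_zpow_or_eq_zpow_mul hs ht h.closure_eq g
    · by_contra hne
      have hord : orderOf (φ a) = 2 ^ (k + 1) :=
        orderOf_eq_prime_pow hne (h.map hφ).pow_eq_one
      refine hg1 (orderOf_dvd_iff_zpow_eq_one.1 ?_)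
      refine (Int.natCast_dvd_natCast.2 (orderOf_dvd_of_pow_eq_one h.pow_eq_one)).trans ?_
      rw [← hord, orderOf_dvd_iff_zpow_eq_one, ← map_zpow, hg]
    · refine absurd ?_ (Subgroup.notMem_zpowers_of_closure_pair_eq_top (h.map hφ).closure_eq hH)
      rw [map_mul, map_zpow] at hg
      exact ⟨-i, by simp [eq_inv_of_mul_eq_one_right hg]⟩
  have h' := h.map hφ
  exact ⟨⟨h'.mul_self.elim id (·.trans hpow), h'.conj.elim id (by simp [hpow]), h'.closure_eq⟩,
    hpow⟩

theorem IsDSQ2Group.exists_isDihedralPair {G : Type} [Group G] (hG : IsDSQ2Group G)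
    {H : Type*} [Group H] {φ : G →* H} (hφ : Function.Surjective φ) (hker : φ.ker ≠ ⊥)
    (hH : ∃ x y : H, x * y ≠ y * x) :
    ∃ a b : H, IsDihedralPair a b ∧ ∃ m, orderOf a = 2 ^ m := by
  obtain ⟨k, a, b, h⟩ := hG.exists_isDSQPair
  obtain ⟨hab, hpow⟩ := h.isDihedralPair_map hφ hker hH
  obtain ⟨m, -, hm⟩ := (Nat.dvd_prime_pow Nat.prime_two).1 (orderOf_dvd_of_pow_eq_one hpow)
  exact ⟨_, _, hab, m, hm⟩

theorem IsDihedralPair.card_eq {G : Type*} [Group G] {a b : G} (h : IsDihedralPair a b)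
    (hG : ∃ x y : G, x * y ≠ y * x) : Nat.card G = 2 * orderOf a := by
  obtain ⟨e, -⟩ := h.exists_mulEquiv hG rfl
  rw [← Nat.card_congr e.toEquiv, DihedralGroup.nat_card]

theorem dihedralProj_r {m n : ℕ} (h : n ∣ m) (i : ℤ) :
    dihedralProj m n h (.r i) = .r i :=
  congrArg _ (map_intCast (ZMod.castHom h (ZMod n)) i)

theorem dihedralProj_sr {m n : ℕ} (h : n ∣ m) (i : ℤ) :
    dihedralProj m n h (.sr i) = .sr i :=
  congrArg _ (map_intCast (ZMod.castHom h (ZMod n)) i)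

theorem DihedralGroup.exists_eq_r_intCast_or_sr_intCast {n : ℕ} (x : DihedralGroup n) :
    ∃ i : ℤ, x = .r i ∨ x = .sr i := by
  rcases x with i | i <;> obtain ⟨i, rfl⟩ := ZMod.intCast_surjective i
  exacts [⟨i, Or.inl rfl⟩, ⟨i, Or.inr rfl⟩]

theorem dihedralProj_dihedralProj {l m n : ℕ} (h : m ∣ l) (h' : n ∣ m) (x : DihedralGroup l) :
    dihedralProj m n h' (dihedralProj l m h x) = dihedralProj l n (h'.trans h) x := by
  obtain ⟨i, rfl | rfl⟩ := x.exists_eq_r_intCast_or_sr_intCast <;>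
    simp only [dihedralProj_r, dihedralProj_sr]

theorem dihedralProj_self {n : ℕ} (x : DihedralGroup n) : dihedralProj n n dvd_rfl x = x := by
  obtain ⟨i, rfl | rfl⟩ := x.exists_eq_r_intCast_or_sr_intCast <;>
    simp only [dihedralProj_r, dihedralProj_sr]

theorem D2inf.dihedralProj_apply {x : ∀ n : ℕ, DihedralGroup (2 ^ n)} (hx : x ∈ D2inf) {m n : ℕ}
    (h : n ≤ m) : dihedralProj (2 ^ m) (2 ^ n) (pow_dvd_pow 2 h) (x m) = x n := by
  induction m, h using Nat.le_induction with
  | base => exact dihedralProj_self _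
  | succ m h ih => rw [← ih, ← hx m, dihedralProj_dihedralProj]

/-- A sequence of finite nonempty types, each mapped into the previous one, contains a
compatible sequence. -/
theorem exists_compatible_seq {X : ℕ → Type} [∀ n, Finite (X n)] [∀ n, Nonempty (X n)]
    (f : ∀ n, X (n + 1) → X n) : ∃ x : ∀ n, X n, ∀ n, f n (x (n + 1)) = x n := by
  let F : CategoryTheory.Functor ℕᵒᵖ Type := CategoryTheory.Functor.ofOpSequence (X := X)
    (fun n => TypeCat.ofHom (f n))
  have : ∀ j, Finite (F.obj j) := fun j => inferInstanceAs (Finite (X j.unop))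
  have : ∀ j, Nonempty (F.obj j) := fun j => inferInstanceAs (Nonempty (X j.unop))
  obtain ⟨u, hu⟩ := nonempty_sections_of_finite_inverse_system F
  refine ⟨fun n => u (Opposite.op n), fun n => ?_⟩
  have := hu (CategoryTheory.homOfLE (Nat.le_add_right n 1)).op
  rw [CategoryTheory.Functor.ofOpSequence_map_homOfLE_succ] at this
  exact this

section InverseLimit

variable {Gr : ℕ → Type} [∀ n, Group (Gr n)] {f : ∀ n, Gr (n + 1) →* Gr n}
  {L : Type} [Group L] {π : ∀ n, L →* Gr n}

theorem exists_transition_hom (hf : ∀ n, Function.Surjective (f n))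
    (hπ : ∀ n x, f n (π (n + 1) x) = π n x) {n m : ℕ} (hnm : n ≤ m) :
    ∃ F : Gr m →* Gr n, Function.Surjective F ∧ ∀ x, F (π m x) = π n x := by
  induction m, hnm using Nat.le_induction with
  | base => exact ⟨MonoidHom.id _, Function.surjective_id, fun _ => rfl⟩
  | succ m _ ih =>
    obtain ⟨F, hF, hFπ⟩ := ih
    exact ⟨F.comp (f m), hF.comp (hf m), fun x => by simp [hπ, hFπ]⟩

theorem exists_transition_hom_ker_ne_bot [∀ n, Finite (Gr n)]
    (hf : ∀ n, Function.Surjective (f n)) (hπ : ∀ n x, f n (π (n + 1) x) = π n x)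
    (hsep : ∀ x y : L, (∀ n, π n x = π n y) → x = y) [Infinite L] (n : ℕ) :
    ∃ m, ∃ F : Gr m →* Gr n, Function.Surjective F ∧ F.ker ≠ ⊥ := by
  by_contra! hcon
  refine not_injective_infinite_finite (π n) fun x y hxy => hsep x y fun m => ?_
  rcases le_total n m with h | h
  · obtain ⟨F, hF, hFπ⟩ := exists_transition_hom hf hπ h
    refine (MonoidHom.ker_eq_bot_iff F).1 (hcon m F hF) ?_
    rw [hFπ, hFπ, hxy]
  · obtain ⟨F, hF, hFπ⟩ := exists_transition_hom hf hπ h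
    rw [← hFπ, hxy, hFπ]

/-- The limit of a surjective inverse system of finite dihedral `2`-groups of unbounded orders,
with compatible generators. -/
theorem nonempty_mulEquiv_D2inf (hπ : ∀ n x, f n (π (n + 1) x) = π n x)
    (hsep : ∀ x y : L, (∀ n, π n x = π n y) → x = y)
    (hlim : ∀ x : ∀ n, Gr n, (∀ n, f n (x (n + 1)) = x n) → ∃ l, ∀ n, π n l = x n)
    (hG : ∀ n, ∃ x y : Gr n, x * y ≠ y * x) {a b : ∀ n, Gr n}
    (hab : ∀ n, IsDihedralPair (a n) (b n))
    (ha : ∀ n, f n (a (n + 1)) = a n) (hb : ∀ n, f n (b (n + 1)) = b n)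
    {k : ℕ → ℕ} (hk : ∀ n, orderOf (a n) = 2 ^ k n) (hunbdd : ∀ j, ∃ n, j ≤ k n) :
    Nonempty (L ≃* D2inf) := by
  have hmono : Monotone k := monotone_nat_of_le_succ fun n => by
    rw [← Nat.pow_dvd_pow_iff_le_right (x := 2) (by norm_num), ← hk, ← hk, ← ha n]
    exact orderOf_map_dvd (f n) _
  choose e her hes using fun n => (hab n).exists_mulEquiv (hG n) (hk n) |>.imp
    fun e he => (⟨fun i => (he i).1, fun i => (he i).2⟩ : (∀ i : ℤ, e (.r i) = a n ^ i) ∧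
      ∀ i : ℤ, e (.sr i) = b n * a n ^ i)
  have hef (n : ℕ) (y : DihedralGroup (2 ^ k (n + 1))) :
      f n (e (n + 1) y) =
        e n (dihedralProj _ _ (pow_dvd_pow 2 (hmono n.le_succ)) y) := by
    obtain ⟨i, rfl | rfl⟩ := y.exists_eq_r_intCast_or_sr_intCast
    · rw [her, dihedralProj_r, her, map_zpow, ha]
    · rw [hes, dihedralProj_sr, hes, map_mul, map_zpow, ha, hb]
  have hex (x : D2inf) : ∃ l, ∀ n, π n l = e n (x.1 (k n)) :=
    hlim (fun n => e n (x.1 (k n))) fun n => by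
      rw [hef, D2inf.dihedralProj_apply x.2 (hmono n.le_succ)]
  choose Φ hΦ using hex
  have hmul (x y : D2inf) : Φ (x * y) = Φ x * Φ y :=
    hsep _ _ fun n => by rw [map_mul, hΦ, hΦ, hΦ, ← map_mul]; rfl
  refine ⟨(MulEquiv.ofBijective (MonoidHom.mk' Φ hmul) ⟨?_, ?_⟩).symm⟩
  · intro x y hxy
    ext j : 2
    obtain ⟨n, hn⟩ := hunbdd j
    have hxy : Φ x = Φ y := hxy
    have : x.1 (k n) = y.1 (k n) := (e n).injective (by rw [← hΦ, ← hΦ, hxy])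
    rw [← D2inf.dihedralProj_apply x.2 hn, this, D2inf.dihedralProj_apply y.2 hn]
  · intro l
    let y (n : ℕ) : DihedralGroup (2 ^ k n) := (e n).symm (π n l)
    have hy (n : ℕ) : dihedralProj _ _ (pow_dvd_pow 2 (hmono n.le_succ)) (y (n + 1)) = y n := by
      apply (e n).injective
      rw [← hef, MulEquiv.apply_symm_apply, MulEquiv.apply_symm_apply, hπ]
    have hy' {n m : ℕ} (h : n ≤ m) :
        dihedralProj _ _ (pow_dvd_pow 2 (hmono h)) (y m) = y n := by
      induction m, h using Nat.le_induction with
      | base => exact dihedralProj_self _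
      | succ m h ih => rw [← ih, ← hy m, dihedralProj_dihedralProj]
    choose N hN using hunbdd
    let x (j : ℕ) : DihedralGroup (2 ^ j) := dihedralProj _ _ (pow_dvd_pow 2 (hN j)) (y (N j))
    have hx {j n : ℕ} (h : j ≤ k n) : x j = dihedralProj _ _ (pow_dvd_pow 2 h) (y n) := by
      rcases le_total n (N j) with hn | hn
      · rw [← hy' hn, dihedralProj_dihedralProj]
      · simp only [x]
        rw [← hy' hn, dihedralProj_dihedralProj]
    have hxmem : x ∈ D2inf := fun j => by
      rw [hx ((Nat.le_succ j).trans (hN (j + 1))), dihedralProj_dihedralProj]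
    have hxy (n : ℕ) : x (k n) = y n := (hx le_rfl).trans (dihedralProj_self _)
    refine ⟨⟨x, hxmem⟩, hsep _ _ fun n => (hΦ _ n).trans ?_⟩
    exact (congrArg (e n) (hxy n)).trans ((e n).apply_symm_apply _)

end InverseLimit

/-- Any proper non-abelian quotient of a finite dihedral, semidihedral, or generalized
quaternion `2`-group is dihedral; consequently, the only infinite inverse limit of a surjective
inverse system of finite dihedral, semidihedral or generalized quaternion `2`-groups is the
infinite pro-`2` dihedral group `D_{2^∞}`. -/
theorem stmt_0 :
    (∀ (G : Type) [Group G] [Finite G], IsDSQ2Group G →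
      ∀ (H : Type) [Group H] (φ : G →* H), Function.Surjective φ → φ.ker ≠ ⊥ →
        (∃ x y : H, x * y ≠ y * x) →
        ∃ m, Nonempty (H ≃* DihedralGroup (2 ^ m))) ∧
    (∀ (Gr : ℕ → Type) [∀ n, Group (Gr n)] [∀ n, Finite (Gr n)],
      (∀ n, IsDSQ2Group (Gr n)) →
      ∀ f : ∀ n, Gr (n + 1) →* Gr n, (∀ n, Function.Surjective (f n)) →
      ∀ (L : Type) [Group L] (π : ∀ n, L →* Gr n),
        (∀ n x, f n (π (n + 1) x) = π n x) →
        (∀ x y : L, (∀ n, π n x = π n y) → x = y) →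
        (∀ x : ∀ n, Gr n, (∀ n, f n (x (n + 1)) = x n) → ∃ l, ∀ n, π n l = x n) →
        Infinite L →
        Nonempty (L ≃* ↥D2inf)) := by
  refine ⟨fun G _ _ hG H _ φ hφ hker hH => ?_, ?_⟩
  · obtain ⟨a, b, hab, m, hm⟩ := hG.exists_isDihedralPair hφ hker hH
    obtain ⟨e, -⟩ := hab.exists_mulEquiv hH hm
    exact ⟨m, ⟨e.symm⟩⟩
  · intro Gr _ _ hGr f hf L _ π hπ hsep hlim _
    have hG n := (hGr n).exists_mul_ne_mul
    have hquot n := exists_transition_hom_ker_ne_bot hf hπ hsep n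
    have hpair (n : ℕ) : ∃ a b : Gr n, IsDihedralPair a b ∧ ∃ m, orderOf a = 2 ^ m := by
      obtain ⟨m, F, hF, hker⟩ := hquot n
      exact (hGr m).exists_isDihedralPair hF hker (hG n)
    let X (n : ℕ) : Type := {p : Gr n × Gr n // IsDihedralPair p.1 p.2}
    have (n : ℕ) : Finite (X n) := Subtype.finite
    have (n : ℕ) : Nonempty (X n) := by
      obtain ⟨a, b, hab, -⟩ := hpair n
      exact ⟨⟨(a, b), hab⟩⟩
    obtain ⟨x, hx⟩ := exists_compatible_seq (X := X)
      fun n p => ⟨(f n p.1.1, f n p.1.2), p.2.map (hf n)⟩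
    have hx n := congrArg Subtype.val (hx n)
    have hcard n := (x n).2.card_eq (hG n)
    have hk (n : ℕ) : ∃ k, orderOf (x n).1.1 = 2 ^ k := by
      obtain ⟨a, b, hab, m, hm⟩ := hpair n
      refine ⟨m, ?_⟩
      have := hab.card_eq (hG n)
      rw [hcard, hm] at this
      omega
    choose k hk using hk
    refine nonempty_mulEquiv_D2inf hπ hsep hlim hG (fun n => (x n).2)
      (fun n => congrArg Prod.fst (hx n)) (fun n => congrArg Prod.snd (hx n)) hk fun j => ?_
    induction j with
    | zero => exact ⟨0, Nat.zero_le _⟩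
    | succ j ih =>
      obtain ⟨n, hn⟩ := ih
      obtain ⟨m, F, hF, hker⟩ := hquot n
      refine ⟨m, hn.trans_lt ((Nat.pow_lt_pow_iff_right (a := 2) (by norm_num)).1 ?_)⟩
      have hlt : Nat.card (Gr n) < Nat.card (Gr m) := by
        refine (Nat.card_le_card_of_surjective F hF).lt_of_ne fun h => hker ?_
        exact (MonoidHom.ker_eq_bot_iff F).2
          ((Nat.bijective_iff_surjective_and_card F).2 ⟨hF, h.symm⟩).1
      rw [hcard, hcard, hk, hk] at hlt
      omega
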